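/- Let S be a finite type of states with a successor relation succ, an initial state s0 and a goal predicate, and let h : S → ℕ be a heuristic with values in ℕ that is descending and dead-end avoiding. If s0 is alive, then there exists a sequence of improving steps from s0 to a goal state of length at most h(s0), since each improving step decreases the ℕ-valued heuristic by at least 1. -/

import Mathlib

/-- A state `s` is reachable from `s0` via the successor relation. -/
def Reachable {S : Type*} (succ : S → S → Prop) (s0 s : S) : Prop :=
  Relation.ReflTransGen succ s0 s

/-- A state `s` is solvable: some goal state is reachable from it. -/
def Solvable {S : Type*} (succ : S → S → Prop) (goal : S → Prop) (s : S) : Prop :=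
  ∃ g, goal g ∧ Relation.ReflTransGen succ s g

/-- A state is alive if it is reachable, solvable, and not a goal. -/
def Alive {S : Type*} (succ : S → S → Prop) (s0 : S) (goal : S → Prop) (s : S) : Prop :=
  Reachable succ s0 s ∧ Solvable succ goal s ∧ ¬ goal s

/-- An improving step for an `ℕ`-valued heuristic. -/
def Improving {S : Type*} (succ : S → S → Prop) (h : S → ℕ) (s s' : S) : Prop :=
  succ s s' ∧ h s' < h s

/-- `h` is descending: every alive state has an improving successor. -/
def Descending {S : Type*} (succ : S → S → Prop) (s0 : S) (goal : S → Prop) (h : S → ℕ) : Prop :=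
  ∀ s, Alive succ s0 goal s → ∃ s', Improving succ h s s'

/-- `h` is dead-end avoiding: every improving successor of an alive state is solvable. -/
def DeadEndAvoiding {S : Type*} (succ : S → S → Prop) (s0 : S) (goal : S → Prop)
    (h : S → ℕ) : Prop :=
  ∀ s s', Alive succ s0 goal s → Improving succ h s s' → Solvable succ goal s'

/-- For an `ℕ`-valued descending, dead-end avoiding heuristic, hill climbing reaches a
goal state from an alive initial state within at most `h s0` improving steps. -/
theorem nat_descending_dda_reaches_goal_bounded {S : Type*} [Fintype S]
    (succ : S → S → Prop) (s0 : S) (goal : S → Prop) (h : S → ℕ)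
    (hdesc : Descending succ s0 goal h) (hdda : DeadEndAvoiding succ s0 goal h)
    (halive : Alive succ s0 goal s0) :
    ∃ n ≤ h s0, ∃ t : ℕ → S, t 0 = s0 ∧
      (∀ i < n, Improving succ h (t i) (t (i + 1))) ∧ goal (t n) := by
  have key : ∀ m s, h s ≤ m → Reachable succ s0 s → Solvable succ goal s →
      ∃ n ≤ h s, ∃ t : ℕ → S, t 0 = s ∧
        (∀ i < n, Improving succ h (t i) (t (i + 1))) ∧ goal (t n) := by
    intro m
    induction m with
    | zero =>
      intro s hs hr hsol
      by_cases hg : goal s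
      · exact ⟨0, Nat.zero_le _, fun _ => s, rfl, fun i hi => absurd hi (Nat.not_lt_zero i), hg⟩
      · obtain ⟨s', _, hlt⟩ := hdesc s ⟨hr, hsol, hg⟩
        omega
    | succ m ih =>
      intro s hs hr hsol
      by_cases hg : goal s
      · exact ⟨0, Nat.zero_le _, fun _ => s, rfl, fun i hi => absurd hi (Nat.not_lt_zero i), hg⟩
      · obtain ⟨s', himp⟩ := hdesc s ⟨hr, hsol, hg⟩
        have hlt := himp.2
        obtain ⟨n, hn, t, ht0, ht, hgt⟩ := ih s' (by omega)
          (Relation.ReflTransGen.tail hr himp.1) (hdda s s' ⟨hr, hsol, hg⟩ himp)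
        refine ⟨n + 1, by omega, fun k => Nat.casesOn k s t, rfl, ?_, hgt⟩
        intro i hi
        cases i with
        | zero =>
          change Improving succ h s (t 0)
          rw [ht0]
          exact himp
        | succ i => exact ht i (by omega)
  exact key (h s0) s0 le_rfl halive.1 halive.2.1
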